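/- There exist constants c, C > 0 and N₀ ∈ ℕ such that for every integer N ≥ N₀, the flatness of Riemann's non-differentiable function in the sense of high-pass filtering satisfies c · log N ≤ F_R(N) ≤ C · log N, where F_R(N) = ‖R_{≥N}‖_{L⁴(𝕋)}⁴ / ‖R_{≥N}‖_{L²(𝕋)}⁴. -/

import Mathlib

open Real MeasureTheory

/-- `σ k = 1` if `k` is a perfect square, `0` otherwise. -/
noncomputable def sqIndicator (k : ℕ) : ℝ := if IsSquare k then 1 else 0

/-- The character `e_k(x) = e^{2πikx}`. -/
noncomputable def eChar (k : ℕ) (x : ℝ) : ℂ :=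
  Complex.exp (2 * Real.pi * Complex.I * (k : ℂ) * (x : ℂ))

/-- Riemann's non-differentiable function `R(x) = ∑_{k≥1} (σ_k/k) e^{2πikx}
    = ∑_{n≥1} e^{2πin²x}/n²`. -/
noncomputable def RiemannF (x : ℝ) : ℂ :=
  ∑' k : ℕ, ((sqIndicator k / k : ℝ) : ℂ) * eChar k x

/-- High-pass filter `R_{≥N}(x) = ∑_{k ≥ N} (σ_k/k) e^{2πikx}`. -/
noncomputable def RiemannHigh (N : ℕ) (x : ℝ) : ℂ :=
  ∑' k : ℕ, if N ≤ k then ((sqIndicator k / k : ℝ) : ℂ) * eChar k x else 0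

/-- The flatness in the sense of high-pass filtering,
`F_R(N) = ‖R_{≥N}‖_{L⁴}⁴ / ‖R_{≥N}‖_{L²}⁴`. -/
noncomputable def flatnessHP (N : ℕ) : ℝ :=
  (∫ x in (0:ℝ)..1, ‖RiemannHigh N x‖ ^ 4) /
    (∫ x in (0:ℝ)..1, ‖RiemannHigh N x‖ ^ 2) ^ 2

lemma eChar_add (k l : ℕ) (x : ℝ) : eChar (k + l) x = eChar k x * eChar l x := by
  simp only [eChar, ← Complex.exp_add]
  congr 1
  push_cast
  ring

lemma norm_eChar (k : ℕ) (x : ℝ) : ‖eChar k x‖ = 1 := by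
  rw [eChar, show 2 * (Real.pi : ℂ) * Complex.I * (k : ℂ) * (x : ℂ)
    = ((2 * Real.pi * k * x : ℝ) : ℂ) * Complex.I by push_cast; ring]
  exact Complex.norm_exp_ofReal_mul_I _

lemma continuous_eChar (k : ℕ) : Continuous (eChar k) := by
  unfold eChar
  fun_prop

lemma integral_eChar_mul_conj (k l : ℕ) :
    ∫ x in (0:ℝ)..1, eChar k x * (starRingEnd ℂ) (eChar l x) = if k = l then 1 else 0 := by
  split_ifs with h
  · subst h
    simp [Complex.mul_conj, Complex.normSq_eq_norm_sq, norm_eChar]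
  · set c : ℂ := 2 * Real.pi * Complex.I * ((k : ℂ) - l) with hc
    have hc0 : c ≠ 0 := by
      have : (k : ℂ) - l ≠ 0 := sub_ne_zero.2 (by exact_mod_cast h)
      simp [hc, this, Real.pi_ne_zero]
    have he : ∀ x : ℝ, eChar k x * (starRingEnd ℂ) (eChar l x) = Complex.exp (c * x) := by
      intro x
      simp only [eChar, ← Complex.exp_conj, ← Complex.exp_add, hc]
      congr 1
      simp only [map_mul, Complex.conj_ofReal, Complex.conj_I, Complex.conj_natCast,
        Complex.conj_ofNat]
      ring
    have h1 : Complex.exp c = 1 := by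
      rw [Complex.exp_eq_one_iff]
      exact ⟨(k : ℤ) - l, by push_cast; rw [hc]; ring⟩
    simp only [he]
    rw [integral_exp_mul_complex hc0]
    simp [h1]

/-- Parseval's identity for an absolutely convergent series with possibly repeated frequencies. -/
lemma hasSum_integral_norm_sq_tsum_eChar {ι : Type*} [Countable ι] (φ : ι → ℕ) (w : ι → ℝ)
    (hw : Summable w) (h0 : ∀ i, 0 ≤ w i) :
    HasSum (fun z : ι × ι => if φ z.1 = φ z.2 then w z.1 * w z.2 else 0)
      (∫ x in (0:ℝ)..1, ‖∑' i, (w i : ℂ) * eChar (φ i) x‖ ^ 2) := by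
  have hn : ∀ x i, ‖(w i : ℂ) * eChar (φ i) x‖ = w i := fun x i => by
    simp [norm_eChar, abs_of_nonneg (h0 i)]
  have hs : ∀ x, Summable fun i => ‖(w i : ℂ) * eChar (φ i) x‖ := fun x => by simpa only [hn]
  set F : ι × ι → ℝ → ℂ := fun z x =>
    ((w z.1 : ℂ) * eChar (φ z.1) x) * (starRingEnd ℂ) ((w z.2 : ℂ) * eChar (φ z.2) x) with hF
  have hFn : ∀ z x, ‖F z x‖ = w z.1 * w z.2 := fun z x => by
    simp only [hF, norm_mul, RCLike.norm_conj, norm_eChar, Complex.norm_real, Real.norm_eq_abs,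
      abs_of_nonneg (h0 _), mul_one]
  have hww : Summable fun z : ι × ι => w z.1 * w z.2 := hw.mul_of_nonneg hw h0 h0
  have key := intervalIntegral.hasSum_integral_of_dominated_convergence (μ := volume)
    (a := 0) (b := 1) (F := F)
    (f := fun x => ((‖∑' i, (w i : ℂ) * eChar (φ i) x‖ ^ 2 : ℝ) : ℂ))
    (fun z _ => w z.1 * w z.2) ?_ ?_ ?_ ?_ ?_
  · rw [intervalIntegral.integral_ofReal] at key
    rw [← Complex.hasSum_ofReal]
    have hterm : ∀ z : ι × ι, ((if φ z.1 = φ z.2 then w z.1 * w z.2 else 0 : ℝ) : ℂ) =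
        ∫ x in (0:ℝ)..1, F z x := fun z => by
      have : ∀ x, F z x = ((w z.1 * w z.2 : ℝ) : ℂ) *
          (eChar (φ z.1) x * (starRingEnd ℂ) (eChar (φ z.2) x)) := fun x => by
        simp only [hF, map_mul, Complex.conj_ofReal]
        push_cast
        ring
      simp only [this]
      rw [intervalIntegral.integral_const_mul, integral_eChar_mul_conj]
      split_ifs <;> simp
    simpa only [hterm] using key
  · intro z
    refine Continuous.aestronglyMeasurable ?_
    have := continuous_eChar (φ z.1)
    have := continuous_eChar (φ z.2)
    simp only [hF, starRingEnd_apply]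
    fun_prop
  · exact fun z => .of_forall fun x _ => (hFn z x).le
  · exact .of_forall fun x _ => hww
  · exact intervalIntegrable_const
  · refine .of_forall fun x _ => ?_
    have h2 : ((‖∑' i, (w i : ℂ) * eChar (φ i) x‖ ^ 2 : ℝ) : ℂ) = ∑' z, F z x := by
      rw [← Complex.normSq_eq_norm_sq, ← Complex.mul_conj, Complex.conj_tsum]
      refine tsum_mul_tsum_of_summable_norm (hs x) ?_
      simpa only [RCLike.norm_conj] using hs x
    rw [h2]
    refine Summable.hasSum (.of_norm ?_)
    simpa only [hFn] using hww

/-- The weights `1/n²` truncated to `n ≥ M`. -/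
noncomputable def tailWeight (M n : ℕ) : ℝ := if M ≤ n then ((n : ℝ) ^ 2)⁻¹ else 0

lemma tailWeight_nonneg (M n : ℕ) : 0 ≤ tailWeight M n := by
  unfold tailWeight
  split_ifs <;> positivity

lemma tailWeight_le (M n : ℕ) : tailWeight M n ≤ ((n : ℝ) ^ 2)⁻¹ := by
  unfold tailWeight
  split_ifs
  · rfl
  · positivity

lemma summable_tailWeight (M : ℕ) : Summable (tailWeight M) :=
  Summable.of_nonneg_of_le (tailWeight_nonneg M) (tailWeight_le M)
    (Real.summable_nat_pow_inv.2 one_lt_two)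

lemma RiemannHigh_eq_tsum_sq {N M : ℕ} (hM : ∀ n, N ≤ n * n ↔ M ≤ n) (x : ℝ) :
    RiemannHigh N x = ∑' n : ℕ, (tailWeight M n : ℂ) * eChar (n ^ 2) x := by
  have hinj : Function.Injective fun n : ℕ => n ^ 2 := Nat.pow_left_injective two_ne_zero
  unfold RiemannHigh
  rw [← hinj.tsum_eq]
  · refine tsum_congr fun n => ?_
    have hs : IsSquare (n ^ 2) := IsSquare.sq n
    have := hM n
    rw [← sq] at this
    simp only [this, sqIndicator, if_pos hs, tailWeight]
    split_ifs <;> simp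
  · intro k hk
    by_contra h
    apply hk
    have : ¬ IsSquare k := fun ⟨r, hr⟩ => h ⟨r, by simp [hr, sq]⟩
    simp [sqIndicator, this]

lemma hasSum_integral_RiemannHigh_sq {N M : ℕ} (hM : ∀ n, N ≤ n * n ↔ M ≤ n) :
    HasSum (fun n => tailWeight M n ^ 2) (∫ x in (0:ℝ)..1, ‖RiemannHigh N x‖ ^ 2) := by
  have h := hasSum_integral_norm_sq_tsum_eChar (fun n => n ^ 2) (tailWeight M)
    (summable_tailWeight M) (tailWeight_nonneg M)
  simp only [← RiemannHigh_eq_tsum_sq hM] at h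
  have hinj : Function.Injective fun n : ℕ => (n, n) := fun a b h => (Prod.ext_iff.1 h).1
  rw [← hinj.hasSum_iff] at h
  · convert h using 1
    ext n
    simp [sq]
  · rintro ⟨n, m⟩ hnm
    refine if_neg fun h => hnm ⟨n, ?_⟩
    simpa using h

/-- The term of the quadruple series for `∫ |R_{≥N}|⁴` indexed by `((n, m), (p, q))`. -/
noncomputable def quadTerm (M : ℕ) (z : (ℕ × ℕ) × (ℕ × ℕ)) : ℝ :=
  if z.1.1 ^ 2 + z.1.2 ^ 2 = z.2.1 ^ 2 + z.2.2 ^ 2 then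
    tailWeight M z.1.1 * tailWeight M z.1.2 * (tailWeight M z.2.1 * tailWeight M z.2.2)
  else 0

lemma hasSum_integral_RiemannHigh_pow_four {N M : ℕ} (hM : ∀ n, N ≤ n * n ↔ M ≤ n) :
    HasSum (quadTerm M) (∫ x in (0:ℝ)..1, ‖RiemannHigh N x‖ ^ 4) := by
  have hs := summable_tailWeight M
  have h0 := tailWeight_nonneg M
  have key := hasSum_integral_norm_sq_tsum_eChar (fun p : ℕ × ℕ => p.1 ^ 2 + p.2 ^ 2)
    (fun p => tailWeight M p.1 * tailWeight M p.2)
    (hs.mul_of_nonneg hs h0 h0) (fun p => mul_nonneg (h0 _) (h0 _))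
  have hpow : ∀ x, ‖RiemannHigh N x‖ ^ 4 = ‖∑' p : ℕ × ℕ,
      ((tailWeight M p.1 * tailWeight M p.2 : ℝ) : ℂ) * eChar (p.1 ^ 2 + p.2 ^ 2) x‖ ^ 2 := by
    intro x
    have hn : Summable fun n => ‖(tailWeight M n : ℂ) * eChar (n ^ 2) x‖ := by
      simpa [norm_eChar, abs_of_nonneg (h0 _)] using hs
    have : RiemannHigh N x ^ 2 = ∑' p : ℕ × ℕ,
        ((tailWeight M p.1 * tailWeight M p.2 : ℝ) : ℂ) * eChar (p.1 ^ 2 + p.2 ^ 2) x := by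
      rw [RiemannHigh_eq_tsum_sq hM, sq, tsum_mul_tsum_of_summable_norm hn hn]
      refine tsum_congr fun p => ?_
      rw [eChar_add]
      push_cast
      ring
    rw [← this, norm_pow]
    ring
  simp only [hpow]
  exact key

lemma sum_le_sum_of_injOn {α β : Type*} {s : Finset α} {t : Finset β} {f : α → ℝ} {g : β → ℝ}
    (e : α → β) (he : ∀ a ∈ s, e a ∈ t) (hinj : Set.InjOn e s) (hfg : ∀ a ∈ s, f a ≤ g (e a))
    (hg : ∀ b ∈ t, 0 ≤ g b) : ∑ a ∈ s, f a ≤ ∑ b ∈ t, g b := by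
  classical
  calc ∑ a ∈ s, f a ≤ ∑ a ∈ s, g (e a) := Finset.sum_le_sum hfg
    _ = ∑ b ∈ s.image e, g b := (Finset.sum_image hinj).symm
    _ ≤ _ := Finset.sum_le_sum_of_subset_of_nonneg (Finset.image_subset_iff.2 he)
        fun b hb _ => hg b hb

lemma sum_inv_sq_le_of_forall_le {s : Finset ℕ} {K : ℕ} (hK : 0 < K) (h : ∀ n ∈ s, K ≤ n) :
    ∑ n ∈ s, ((n : ℝ) ^ 2)⁻¹ ≤ 2 / K := by
  obtain ⟨k, rfl⟩ : ∃ k, K = k + 1 := ⟨K - 1, by omega⟩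
  calc ∑ n ∈ s, ((n : ℝ) ^ 2)⁻¹ ≤ ∑ n ∈ Finset.Ioo k (s.sup id + 1), ((n : ℝ) ^ 2)⁻¹ := by
        refine Finset.sum_le_sum_of_subset_of_nonneg (fun n hn => ?_) fun _ _ _ => by positivity
        have h1 := h n hn
        have h2 : n ≤ s.sup id := Finset.le_sup (f := id) hn
        exact Finset.mem_Ioo.2 ⟨by omega, by omega⟩
    _ ≤ 2 / (k + 1 : ℝ) := sum_Ioo_inv_sq_le k _
    _ = _ := by push_cast; rfl

lemma div_le_card_filter_dvd_Ioc (M g : ℕ) :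
    M / g ≤ ((Finset.Ioc M (2 * M)).filter (g ∣ ·)).card := by
  have h1 := Nat.Ioc_filter_dvd_card_eq_div M g
  have h2 := Nat.Ioc_filter_dvd_card_eq_div (2 * M) g
  have h3 : M / g + M / g ≤ (2 * M) / g := by
    rw [two_mul]; exact Nat.div_add_div_le_add_div
  rw [← Finset.Ioc_union_Ioc_eq_Ioc (Nat.zero_le M) (by omega : M ≤ 2 * M),
    Finset.filter_union] at h2
  have := Finset.card_union_le ((Finset.Ioc 0 M).filter (g ∣ ·))
    ((Finset.Ioc M (2 * M)).filter (g ∣ ·))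
  omega

lemma log_le_two_mul_sum_totient_div_sq (M : ℕ) :
    Real.log M ≤ 2 * ∑ g ∈ Finset.Icc 1 M, (Nat.totient g : ℝ) / g ^ 2 := by
  rcases Nat.eq_zero_or_pos M with rfl | hM
  · simp
  have h1 : Real.log M ≤ ∑ n ∈ Finset.Icc 1 M, (n : ℝ)⁻¹ := by
    have := log_add_one_le_harmonic M
    rw [harmonic_eq_sum_Icc] at this
    push_cast at this
    refine le_trans (Real.log_le_log (by exact_mod_cast hM) ?_) this
    linarith
  refine h1.trans ?_
  have h2 : ∀ n ∈ Finset.Icc 1 M, (n : ℝ)⁻¹ =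
      ∑ g ∈ n.divisors, (Nat.totient g : ℝ) / g ^ 2 * (((n / g : ℕ) : ℝ) ^ 2)⁻¹ := by
    intro n hn
    have hn1 : 1 ≤ n := (Finset.mem_Icc.1 hn).1
    have hn0 : (n : ℝ) ≠ 0 := by positivity
    have : ∀ g ∈ n.divisors, (Nat.totient g : ℝ) / g ^ 2 * (((n / g : ℕ) : ℝ) ^ 2)⁻¹
        = (Nat.totient g : ℝ) * ((n : ℝ) ^ 2)⁻¹ := by
      intro g hg
      have hgd := Nat.dvd_of_mem_divisors hg
      have hg0 : (g : ℝ) ≠ 0 := by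
        have := Nat.pos_of_mem_divisors hg
        positivity
      rw [Nat.cast_div hgd hg0]
      field_simp
    rw [Finset.sum_congr rfl this, ← Finset.sum_mul, ← Nat.cast_sum, Nat.sum_totient]
    field_simp
  rw [Finset.sum_congr rfl h2, Finset.sum_sigma', Finset.mul_sum]
  calc _ ≤ ∑ p ∈ Finset.Icc 1 M ×ˢ Finset.Icc 1 M,
        (Nat.totient p.1 : ℝ) / p.1 ^ 2 * ((p.2 : ℝ) ^ 2)⁻¹ := by
        refine sum_le_sum_of_injOn (fun p => (p.2, p.1 / p.2)) ?_ ?_ (fun _ _ => le_rfl)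
          fun _ _ => by positivity
        · rintro ⟨n, g⟩ h
          simp only [Finset.mem_sigma, Finset.mem_Icc, Nat.mem_divisors] at h
          have hg := Nat.pos_of_dvd_of_pos h.2.1 h.1.1
          have hgn := Nat.le_of_dvd h.1.1 h.2.1
          simp only [Finset.mem_product, Finset.mem_Icc]
          exact ⟨⟨hg, hgn.trans h.1.2⟩, Nat.div_pos hgn hg, (Nat.div_le_self _ _).trans h.1.2⟩
        · rintro ⟨n, g⟩ h ⟨n', g'⟩ h' heq
          simp only [Finset.coe_sigma, Set.mem_sigma_iff, Finset.mem_coe, Nat.mem_divisors] at h h'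
          simp only [Prod.mk.injEq] at heq
          obtain ⟨rfl, he⟩ := heq
          rw [Nat.div_left_inj h.2.1 h'.2.1] at he
          rw [he]
    _ = ∑ g ∈ Finset.Icc 1 M, (Nat.totient g : ℝ) / g ^ 2 *
          ∑ k ∈ Finset.Icc 1 M, ((k : ℝ) ^ 2)⁻¹ := by
        rw [Finset.sum_product]
        simp only [Finset.mul_sum]
    _ ≤ _ := by
        refine Finset.sum_le_sum fun g _ => ?_
        rw [mul_comm]
        have := sum_inv_sq_le_of_forall_le (s := Finset.Icc 1 M) one_pos
          fun n hn => (Finset.mem_Icc.1 hn).1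
        refine mul_le_mul_of_nonneg_right (by simpa using this) (by positivity)

lemma sq_mul_log_le_sum_gcd (M : ℕ) :
    (M : ℝ) ^ 2 * Real.log M ≤
      8 * ∑ p ∈ Finset.Ioc M (2 * M) ×ˢ Finset.Ioc M (2 * M), (Nat.gcd p.1 p.2 : ℝ) := by
  set I := Finset.Ioc M (2 * M) with hI
  have h1 : ∑ g ∈ Finset.Icc 1 M, (Nat.totient g : ℝ) * (((I.filter (g ∣ ·)).card : ℝ)) ^ 2 ≤
      ∑ p ∈ I ×ˢ I, (Nat.gcd p.1 p.2 : ℝ) := by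
    have e1 : ∀ g, (Nat.totient g : ℝ) * (((I.filter (g ∣ ·)).card : ℝ)) ^ 2 =
        ∑ p ∈ I ×ˢ I, if g ∣ p.1 ∧ g ∣ p.2 then (Nat.totient g : ℝ) else 0 := by
      intro g
      rw [← Finset.sum_filter, Finset.filter_product (p := (g ∣ ·)) (q := (g ∣ ·)),
        Finset.sum_const, Finset.card_product, nsmul_eq_mul]
      push_cast
      ring
    simp only [e1]
    rw [Finset.sum_comm]
    refine Finset.sum_le_sum fun p hp => ?_
    have hp1 := (Finset.mem_Ioc.1 (Finset.mem_product.1 hp).1).1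
    rw [← Finset.sum_filter]
    conv_rhs => rw [← Nat.sum_totient (Nat.gcd p.1 p.2), Nat.cast_sum]
    refine Finset.sum_le_sum_of_subset_of_nonneg (fun g hg => ?_) fun _ _ _ => by positivity
    rw [Finset.mem_filter] at hg
    exact Nat.mem_divisors.2 ⟨Nat.dvd_gcd hg.2.1 hg.2.2,
      (Nat.gcd_pos_of_pos_left _ (by omega)).ne'⟩
  have h2 : ∀ g ∈ Finset.Icc 1 M, (M : ℝ) ^ 2 * ((Nat.totient g : ℝ) / g ^ 2) ≤
      4 * ((Nat.totient g : ℝ) * (((I.filter (g ∣ ·)).card : ℝ)) ^ 2) := by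
    intro g hg
    obtain ⟨hg1, hg2⟩ := Finset.mem_Icc.1 hg
    have hc : M ≤ 2 * (g * (I.filter (g ∣ ·)).card) := by
      have h3 := div_le_card_filter_dvd_Ioc M g
      have h4 : 1 ≤ M / g := Nat.div_pos hg2 hg1
      have h5 := Nat.div_add_mod M g
      have h6 := Nat.mod_lt M hg1
      have h7 : g * (M / g) ≤ g * (I.filter (g ∣ ·)).card := Nat.mul_le_mul_left g h3
      have h8 : g * 1 ≤ g * (M / g) := Nat.mul_le_mul_left g h4
      omega
    have hc' : (M : ℝ) ≤ 2 * (g * (I.filter (g ∣ ·)).card) := by exact_mod_cast hc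
    have hc2 := pow_le_pow_left₀ (by positivity) hc' 2
    have hg0 : (0 : ℝ) < g := by exact_mod_cast hg1
    rw [← mul_div_assoc, div_le_iff₀ (by positivity)]
    have := mul_le_mul_of_nonneg_right hc2 (Nat.cast_nonneg (α := ℝ) (Nat.totient g))
    linarith
  have h3 := Finset.sum_le_sum h2
  rw [← Finset.mul_sum, ← Finset.mul_sum] at h3
  have h4 := mul_le_mul_of_nonneg_left (log_le_two_mul_sum_totient_div_sq M)
    (sq_nonneg (M : ℝ))
  linarith

lemma quadTerm_nonneg (M : ℕ) (z : (ℕ × ℕ) × (ℕ × ℕ)) : 0 ≤ quadTerm M z := by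
  have h := tailWeight_nonneg M
  unfold quadTerm
  split_ifs
  · exact mul_nonneg (mul_nonneg (h _) (h _)) (mul_nonneg (h _) (h _))
  · rfl

lemma inv_pow_le_quadTerm {M L : ℕ} (hM : 0 < M) {z : (ℕ × ℕ) × (ℕ × ℕ)}
    (hz : z.1.1 ^ 2 + z.1.2 ^ 2 = z.2.1 ^ 2 + z.2.2 ^ 2)
    (h1 : M ≤ z.1.1 ∧ z.1.1 ≤ L) (h2 : M ≤ z.1.2 ∧ z.1.2 ≤ L)
    (h3 : M ≤ z.2.1 ∧ z.2.1 ≤ L) (h4 : M ≤ z.2.2 ∧ z.2.2 ≤ L) :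
    ((L : ℝ) ^ 8)⁻¹ ≤ quadTerm M z := by
  have key : ∀ n, M ≤ n ∧ n ≤ L → ((L : ℝ) ^ 2)⁻¹ ≤ tailWeight M n := by
    intro n hn
    have : (0 : ℝ) < n := by exact_mod_cast lt_of_lt_of_le hM hn.1
    have hL : (n : ℝ) ≤ L := by exact_mod_cast hn.2
    rw [tailWeight, if_pos hn.1]
    gcongr
  rw [quadTerm, if_pos hz]
  calc ((L : ℝ) ^ 8)⁻¹ = ((L : ℝ) ^ 2)⁻¹ * ((L : ℝ) ^ 2)⁻¹ * (((L : ℝ) ^ 2)⁻¹ * ((L : ℝ) ^ 2)⁻¹) := by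
        simp only [← mul_inv]
        ring
    _ ≤ _ := by
      have := tailWeight_nonneg M
      gcongr
      · exact mul_nonneg (this _) (this _)
      · exact this _
      all_goals first | exact key _ h1 | exact key _ h2 | exact key _ h3 | exact key _ h4 | exact this _

/-- Lower bound for the quadruple series, from the solutions `n = u + v`, `p = v - u`, `q = u' + v'`,
`m = v' - u'` with `u v = u' v'`. -/
lemma log_le_of_hasSum_quadTerm {M : ℕ} (hM : 0 < M) {T : ℝ} (hT : HasSum (quadTerm M) T) :
    Real.log M / (8 * 10 ^ 8 * (M : ℝ) ^ 6) ≤ T := by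
  classical
  set I := Finset.Ioc M (2 * M)
  set s : Finset (Σ _ : ℕ × ℕ, ℕ) := (I ×ˢ I).sigma fun p =>
    Finset.Ico (3 * Nat.gcd p.1 p.2) (4 * Nat.gcd p.1 p.2)
  let e : (Σ _ : ℕ × ℕ, ℕ) → (ℕ × ℕ) × (ℕ × ℕ) := fun p =>
    ((p.1.1 + p.1.2 / Nat.gcd p.1.1 p.1.2 * p.2, p.1.1 / Nat.gcd p.1.1 p.1.2 * p.2 - p.1.2),
     (p.1.2 / Nat.gcd p.1.1 p.1.2 * p.2 - p.1.1, p.1.2 + p.1.1 / Nat.gcd p.1.1 p.1.2 * p.2))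
  have facts : ∀ p ∈ s, ∃ v v', v = p.1.2 / Nat.gcd p.1.1 p.1.2 * p.2 ∧
      v' = p.1.1 / Nat.gcd p.1.1 p.1.2 * p.2 ∧ p.1.1 * v = p.1.2 * v' ∧
      M < p.1.1 ∧ p.1.1 ≤ 2 * M ∧ M < p.1.2 ∧ p.1.2 ≤ 2 * M ∧
      3 * M ≤ v ∧ v ≤ 8 * M ∧ 3 * M ≤ v' ∧ v' ≤ 8 * M ∧ 0 < p.1.2 / Nat.gcd p.1.1 p.1.2 := by
    rintro ⟨⟨u, u'⟩, d⟩ hp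
    simp only [s, I, Finset.mem_sigma, Finset.mem_product, Finset.mem_Ioc, Finset.mem_Ico] at hp
    obtain ⟨⟨⟨hu1, hu2⟩, hu'1, hu'2⟩, hd1, hd2⟩ := hp
    have hg : 0 < Nat.gcd u u' := Nat.gcd_pos_of_pos_left _ (by omega)
    obtain ⟨a, ha⟩ := Nat.gcd_dvd_left u u'
    obtain ⟨b, hb⟩ := Nat.gcd_dvd_right u u'
    set g := Nat.gcd u u'
    have ha' : u / g = a := by rw [ha, Nat.mul_div_cancel_left _ hg]
    have hb' : u' / g = b := by rw [hb, Nat.mul_div_cancel_left _ hg]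
    refine ⟨b * d, a * d, by simp only [hb'], by simp only [ha'], ?_, hu1, hu2, hu'1, hu'2,
      ?_, ?_, ?_, ?_, ?_⟩
    · dsimp only
      rw [ha, hb]; ring
    · nlinarith [Nat.mul_le_mul_left b hd1]
    · nlinarith [Nat.mul_le_mul_left b hd2.le]
    · nlinarith [Nat.mul_le_mul_left a hd1]
    · nlinarith [Nat.mul_le_mul_left a hd2.le]
    · dsimp only
      rw [hb']
      rcases Nat.eq_zero_or_pos b with rfl | h
      · omega
      · exact h
  have h1 : ∑ p ∈ s, (((10 * M : ℕ) : ℝ) ^ 8)⁻¹ ≤ ∑ z ∈ s.image e, quadTerm M z := by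
    refine sum_le_sum_of_injOn e (fun a ha => Finset.mem_image_of_mem e ha) ?_ ?_
      fun z _ => quadTerm_nonneg M z
    · intro p hp p' hp' heq
      obtain ⟨v, v', hv, hv', h⟩ := facts p hp
      obtain ⟨w, w', hw, hw', h'⟩ := facts p' hp'
      simp only [e, ← hv, ← hv', ← hw, ← hw', Prod.mk.injEq] at heq
      have e1 : p.1.1 = p'.1.1 := by omega
      have e2 : p.1.2 = p'.1.2 := by omega
      have e3 : v = w := by omega
      have e4 : p.1 = p'.1 := Prod.ext e1 e2
      rw [hv, hw, ← e4] at e3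
      have e5 : p.2 = p'.2 := Nat.eq_of_mul_eq_mul_left h.2.2.2.2.2.2.2.2.2 e3
      exact Sigma.ext e4 (heq_of_eq e5)
    · intro p hp
      obtain ⟨v, v', hv, hv', h, h'⟩ := facts p hp
      refine inv_pow_le_quadTerm hM ?_ ?_ ?_ ?_ ?_ <;> simp only [e, ← hv, ← hv']
      · obtain ⟨x, hx⟩ : ∃ x, v = p.1.1 + x := ⟨v - p.1.1, by omega⟩
        obtain ⟨y, hy⟩ : ∃ y, v' = p.1.2 + y := ⟨v' - p.1.2, by omega⟩
        rw [hx, hy, Nat.add_sub_cancel_left, Nat.add_sub_cancel_left]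
        rw [hx, hy] at h
        nlinarith
      all_goals omega
  have h2 := h1.trans (sum_le_hasSum _ (fun z _ => quadTerm_nonneg M z) hT)
  have h3 : ∑ p ∈ s, (((10 * M : ℕ) : ℝ) ^ 8)⁻¹ =
      (∑ p ∈ I ×ˢ I, (Nat.gcd p.1 p.2 : ℝ)) * (((10 * M : ℕ) : ℝ) ^ 8)⁻¹ := by
    rw [Finset.sum_sigma, Finset.sum_mul]
    refine Finset.sum_congr rfl fun p _ => ?_
    rw [Finset.sum_const, Nat.card_Ico, nsmul_eq_mul,
      show 4 * Nat.gcd p.1 p.2 - 3 * Nat.gcd p.1 p.2 = Nat.gcd p.1 p.2 by omega]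
  rw [h3] at h2
  refine le_trans ?_ h2
  have h4 := sq_mul_log_le_sum_gcd M
  have hM' : (0 : ℝ) < M := by exact_mod_cast hM
  rw [div_le_iff₀ (by positivity)]
  push_cast
  have : (∑ p ∈ I ×ˢ I, (Nat.gcd p.1 p.2 : ℝ)) * ((10 * (M : ℝ)) ^ 8)⁻¹ *
      (8 * 10 ^ 8 * (M : ℝ) ^ 6) = 8 * (∑ p ∈ I ×ˢ I, (Nat.gcd p.1 p.2 : ℝ)) / (M : ℝ) ^ 2 := by
    field_simp
  rw [this, le_div_iff₀ (by positivity)]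
  linarith

lemma sum_tailWeight_sq_le {M : ℕ} (hM : 0 < M) (s : Finset ℕ) :
    ∑ n ∈ s, tailWeight M n ^ 2 ≤ 2 / (M : ℝ) ^ 3 := by
  have hM' : (0 : ℝ) < M := by exact_mod_cast hM
  calc ∑ n ∈ s, tailWeight M n ^ 2
      ≤ ∑ n ∈ s, if M ≤ n then ((M : ℝ) ^ 2)⁻¹ * ((n : ℝ) ^ 2)⁻¹ else 0 := by
        refine Finset.sum_le_sum fun n _ => ?_
        unfold tailWeight
        split_ifs with h
        · have : (M : ℝ) ≤ n := by exact_mod_cast h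
          rw [sq (((n : ℝ) ^ 2)⁻¹)]
          gcongr
        · simp
    _ = ((M : ℝ) ^ 2)⁻¹ * ∑ n ∈ s.filter (M ≤ ·), ((n : ℝ) ^ 2)⁻¹ := by
        rw [← Finset.sum_filter, Finset.mul_sum]
    _ ≤ ((M : ℝ) ^ 2)⁻¹ * (2 / M) := by
        gcongr
        exact sum_inv_sq_le_of_forall_le hM fun n hn => (Finset.mem_filter.1 hn).2
    _ = _ := by field_simp

lemma le_of_hasSum_tailWeight_sq {M : ℕ} (hM : 0 < M) {S : ℝ}
    (hS : HasSum (fun n => tailWeight M n ^ 2) S) : 1 / (16 * (M : ℝ) ^ 3) ≤ S := by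
  have hM' : (0 : ℝ) < M := by exact_mod_cast hM
  refine le_trans ?_ (sum_le_hasSum (Finset.Ico M (2 * M)) (fun n _ => sq_nonneg _) hS)
  calc 1 / (16 * (M : ℝ) ^ 3) = ∑ n ∈ Finset.Ico M (2 * M), (((2 * M : ℝ)) ^ 4)⁻¹ := by
        rw [Finset.sum_const, Nat.card_Ico, nsmul_eq_mul, show 2 * M - M = M by omega]
        field_simp
        norm_num
    _ ≤ _ := by
        refine Finset.sum_le_sum fun n hn => ?_
        obtain ⟨h1, h2⟩ := Finset.mem_Ico.1 hn
        have h3 : (n : ℝ) ≤ 2 * M := by exact_mod_cast h2.le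
        have h4 : (0 : ℝ) < n := by exact_mod_cast hM.trans_le h1
        rw [tailWeight, if_pos h1, inv_pow, ← pow_mul]
        gcongr

lemma exists_four_factors {x y z w : ℕ} (hx : 0 < x) (h : x * y = z * w) :
    ∃ a b c d, x = a * b ∧ y = c * d ∧ z = a * c ∧ w = b * d := by
  obtain ⟨a, b, ⟨c, hc⟩, ⟨d, hd⟩, rfl⟩ := exists_dvd_and_dvd_of_dvd_mul (Dvd.intro y h)
  refine ⟨a, b, c, d, rfl, Nat.eq_of_mul_eq_mul_left hx ?_, hc, hd⟩
  rw [h, hc, hd]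
  ring

/-- Divisor parametrization of the solutions of `n² + m² = p² + q²` with `p < n`. -/
lemma exists_parametrization {n m p q : ℕ} (h : n ^ 2 + m ^ 2 = p ^ 2 + q ^ 2) (hp : 0 < p)
    (hm : 0 < m) (hpn : p < n) :
    ∃ a b c d, n = p + a * b ∧ n + p = c * d ∧ q = m + a * c ∧ q + m = b * d ∧ a < d := by
  have hmq : m < q := by
    by_contra! hle
    nlinarith [Nat.pow_le_pow_left hle 2, Nat.pow_lt_pow_left hpn two_ne_zero]
  obtain ⟨x, rfl⟩ : ∃ x, n = p + x := ⟨n - p, by omega⟩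
  obtain ⟨z, rfl⟩ : ∃ z, q = m + z := ⟨q - m, by omega⟩
  have hx : 0 < x := by omega
  have hprod : x * (p + x + p) = z * (m + z + m) := by nlinarith
  obtain ⟨a, b, c, d, h1, h2, h3, h4⟩ := exists_four_factors hx hprod
  refine ⟨a, b, c, d, by rw [h1], h2, by rw [h3], h4, ?_⟩
  by_contra! hda
  have h5 : a * b < c * d := by omega
  have h6 : a * c < b * d := by omega
  rcases le_total b c with hbc | hbc
  · nlinarith [Nat.mul_le_mul_left b hda, Nat.mul_le_mul_left a hbc]
  · nlinarith [Nat.mul_le_mul_left c hda, Nat.mul_le_mul_left a hbc]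

lemma quadTerm_le {M a b c d n m p q : ℕ} (hM : 0 < M) (hn : n = p + a * b) (hnp : n + p = c * d)
    (hq : q = m + a * c) (hqm : q + m = b * d) :
    quadTerm M ((n, m), (p, q)) ≤
      16 / (M : ℝ) ^ 4 * (((d : ℝ) ^ 4)⁻¹ * (((b : ℝ) ^ 2)⁻¹ * ((c : ℝ) ^ 2)⁻¹)) := by
  have hnn := tailWeight_nonneg M
  have hbig : ∀ k, tailWeight M k ≤ ((M : ℝ) ^ 2)⁻¹ := by
    intro k
    unfold tailWeight
    split_ifs with h
    · have h1 : (0 : ℝ) < M := by exact_mod_cast hM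
      have h2 : (M : ℝ) ≤ k := by exact_mod_cast h
      gcongr
    · positivity
  have hpair : ∀ k l x : ℕ, k = l + x → ∀ y z : ℕ, k + l = y * z →
      tailWeight M k ≤ 4 * (((y : ℝ) ^ 2)⁻¹ * ((z : ℝ) ^ 2)⁻¹) := by
    intro k l x hk y z hkl
    unfold tailWeight
    split_ifs with h
    · have h1 : (0 : ℝ) < (y * z : ℕ) := by
        have : 0 < y * z := by omega
        exact_mod_cast this
      have h2 : ((y * z : ℕ) : ℝ) ≤ 2 * k := by
        have : y * z ≤ 2 * k := by omega
        exact_mod_cast this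
      have h3 : (0 : ℝ) < k := by linarith
      rw [← mul_inv, ← mul_pow, ← Nat.cast_mul, ← div_eq_mul_inv, inv_le_comm₀ (by positivity)
        (by positivity), inv_div, div_le_iff₀ (by norm_num)]
      nlinarith
    · positivity
  unfold quadTerm
  split_ifs
  · calc _ ≤ (4 * (((c : ℝ) ^ 2)⁻¹ * ((d : ℝ) ^ 2)⁻¹)) * ((M : ℝ) ^ 2)⁻¹ *
          (((M : ℝ) ^ 2)⁻¹ * (4 * (((b : ℝ) ^ 2)⁻¹ * ((d : ℝ) ^ 2)⁻¹))) := by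
          have h1 := hpair n p _ hn c d hnp
          have h2 := hpair q m _ hq b d hqm
          exact mul_le_mul (mul_le_mul h1 (hbig m) (hnn _) (by positivity))
            (mul_le_mul (hbig p) h2 (hnn _) (by positivity)) (mul_nonneg (hnn _) (hnn _))
            (by positivity)
      _ = _ := by
          simp only [← inv_pow, div_eq_mul_inv]
          ring
  · positivity

lemma sum_inv_cube_mul_sq_le {M K : ℕ} (hM : 0 < M) :
    ∑ d ∈ Finset.Icc 1 K, ((d : ℝ) ^ 3)⁻¹ *
      (∑ b ∈ (Finset.Icc 1 K).filter (fun b => 2 * M ≤ b * d), ((b : ℝ) ^ 2)⁻¹) ^ 2 ≤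
    (9 + Real.log M) / (M : ℝ) ^ 2 := by
  have hM' : (0 : ℝ) < M := by exact_mod_cast hM
  set B : ℕ → ℝ := fun d =>
    ∑ b ∈ (Finset.Icc 1 K).filter (fun b => 2 * M ≤ b * d), ((b : ℝ) ^ 2)⁻¹ with hB
  have hB0 : ∀ d, 0 ≤ B d := fun d => Finset.sum_nonneg fun _ _ => by positivity
  have hB1 : ∀ d, B d ≤ 2 := fun d => by
    simpa using sum_inv_sq_le_of_forall_le (K := 1) one_pos fun n hn =>
      (Finset.mem_Icc.1 (Finset.mem_filter.1 hn).1).1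
  have hB2 : ∀ d, 0 < d → B d ≤ d / M := fun d hd => by
    have hd' : (0 : ℝ) < d := by exact_mod_cast hd
    obtain ⟨k, hk1, hkmin⟩ : ∃ k, 2 * M ≤ k * d ∧ ∀ n, 2 * M ≤ n * d → k ≤ n := by
      classical
      have hex : ∃ k, 2 * M ≤ k * d := ⟨2 * M, Nat.le_mul_of_pos_right _ hd⟩
      exact ⟨Nat.find hex, Nat.find_spec hex, fun n hn => Nat.find_min' hex hn⟩
    have hk0 : 0 < k := Nat.pos_of_mul_pos_right (show 0 < k * d by omega)
    have h1 : B d ≤ 2 / k := sum_inv_sq_le_of_forall_le hk0 fun n hn =>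
      hkmin n (Finset.mem_filter.1 hn).2
    refine h1.trans ?_
    have h3 : 2 * (M : ℝ) ≤ k * d := by exact_mod_cast hk1
    have h4 : (0 : ℝ) < k := by exact_mod_cast hk0
    rw [div_le_div_iff₀ h4 hM']
    linarith
  rw [← Finset.sum_filter_add_sum_filter_not _ (fun d => d ≤ M)]
  have hlow : ∑ d ∈ (Finset.Icc 1 K).filter (fun d => d ≤ M), ((d : ℝ) ^ 3)⁻¹ * B d ^ 2 ≤
      (1 + Real.log M) * ((M : ℝ) ^ 2)⁻¹ := by
    have hh := harmonic_le_one_add_log M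
    rw [harmonic_eq_sum_Icc] at hh
    push_cast at hh
    refine le_trans ?_ (mul_le_mul_of_nonneg_right hh (by positivity))
    rw [Finset.sum_mul]
    refine (Finset.sum_le_sum (g := fun d : ℕ => (d : ℝ)⁻¹ * ((M : ℝ) ^ 2)⁻¹)
      fun d hd => ?_).trans (Finset.sum_le_sum_of_subset_of_nonneg (fun d hd => ?_)
        fun _ _ _ => by positivity)
    · have hd1 : 0 < d := (Finset.mem_Icc.1 (Finset.mem_filter.1 hd).1).1
      have hd' : (0 : ℝ) < d := by exact_mod_cast hd1
      calc _ ≤ ((d : ℝ) ^ 3)⁻¹ * (d / M) ^ 2 := by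
            have := hB2 d hd1
            have := hB0 d
            gcongr
        _ = _ := by field_simp
    · have h := Finset.mem_filter.1 hd
      exact Finset.mem_Icc.2 ⟨(Finset.mem_Icc.1 h.1).1, h.2⟩
  have hhigh : ∑ d ∈ (Finset.Icc 1 K).filter (fun d => ¬ d ≤ M), ((d : ℝ) ^ 3)⁻¹ * B d ^ 2 ≤
      8 * ((M : ℝ) ^ 2)⁻¹ := by
    calc _ ≤ ∑ d ∈ (Finset.Icc 1 K).filter (fun d => ¬ d ≤ M), 4 / (M : ℝ) * ((d : ℝ) ^ 2)⁻¹ := by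
          refine Finset.sum_le_sum fun d hd => ?_
          have hd1 : M ≤ d := (not_le.1 (Finset.mem_filter.1 hd).2).le
          have hd' : (M : ℝ) ≤ d := by exact_mod_cast hd1
          have hd0 : (0 : ℝ) < d := hM'.trans_le hd'
          calc _ ≤ ((d : ℝ) ^ 3)⁻¹ * 2 ^ 2 := by
                have := hB1 d
                have := hB0 d
                gcongr
            _ = 4 / (d : ℝ) * ((d : ℝ) ^ 2)⁻¹ := by field_simp; norm_num
            _ ≤ _ := by gcongr
      _ ≤ 4 / (M : ℝ) * (2 / M) := by
          rw [← Finset.mul_sum]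
          gcongr
          exact sum_inv_sq_le_of_forall_le hM fun n hn =>
            (not_le.1 (Finset.mem_filter.1 hn).2).le
      _ = _ := by field_simp; norm_num
  refine (add_le_add hlow hhigh).trans (le_of_eq ?_)
  rw [div_eq_mul_inv]
  ring

lemma sum_quadTerm_le_of_lt {M : ℕ} (hM : 0 < M) (s : Finset ((ℕ × ℕ) × (ℕ × ℕ)))
    (hs : ∀ z ∈ s, z.2.1 < z.1.1) :
    ∑ z ∈ s, quadTerm M z ≤ 16 * (9 + Real.log M) / (M : ℝ) ^ 6 := by
  classical
  have hM' : (0 : ℝ) < M := by exact_mod_cast hM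
  set s' := s.filter fun z => quadTerm M z ≠ 0 with hs'
  have hsum : ∑ z ∈ s, quadTerm M z = ∑ z ∈ s', quadTerm M z := (Finset.sum_filter_ne_zero s).symm
  have hex : ∀ z : (ℕ × ℕ) × (ℕ × ℕ), ∃ r : Σ _ : ℕ, ℕ × ℕ × ℕ, z ∈ s' →
      z.1.1 = z.2.1 + r.2.1 * r.2.2.1 ∧ z.1.1 + z.2.1 = r.2.2.2 * r.1 ∧
      z.2.2 = z.1.2 + r.2.1 * r.2.2.2 ∧ z.2.2 + z.1.2 = r.2.2.1 * r.1 ∧ r.2.1 < r.1 ∧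
      M ≤ z.2.1 ∧ M ≤ z.1.2 := by
    rintro ⟨⟨n, m⟩, p, q⟩
    by_cases hz : ((n, m), p, q) ∈ s'
    · obtain ⟨hz1, hz2⟩ := Finset.mem_filter.1 hz
      have hlt := hs _ hz1
      simp only [quadTerm, ne_eq, ite_eq_right_iff, mul_eq_zero, not_forall, not_or] at hz2
      obtain ⟨heq, ⟨-, hm⟩, hp, -⟩ := hz2
      have hle : ∀ k, tailWeight M k ≠ 0 → M ≤ k := fun k hk => by
        by_contra h
        exact hk (if_neg h)
      have hm' := hle m hm
      have hp' := hle p hp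
      obtain ⟨a, b, c, d, h1, h2, h3, h4, h5⟩ :=
        exists_parametrization heq (hM.trans_le hp') (hM.trans_le hm') hlt
      exact ⟨⟨d, a, b, c⟩, fun _ => ⟨h1, h2, h3, h4, h5, hp', hm'⟩⟩
    · exact ⟨⟨0, 0, 0, 0⟩, fun h => absurd h hz⟩
  choose e he using hex
  set K := ∑ z ∈ s', (z.1.1 + z.2.1 + z.2.2 + z.1.2) with hK
  have hzK : ∀ z ∈ s', z.1.1 + z.2.1 + z.2.2 + z.1.2 ≤ K := fun z hz =>
    Finset.single_le_sum (f := fun z : (ℕ × ℕ) × (ℕ × ℕ) => z.1.1 + z.2.1 + z.2.2 + z.1.2)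
      (fun _ _ => Nat.zero_le _) hz
  set B : ℕ → Finset ℕ := fun d => (Finset.Icc 1 K).filter fun b => 2 * M ≤ b * d with hB
  rw [hsum]
  calc _ ≤ ∑ r ∈ (Finset.Icc 1 K).sigma fun d => Finset.range d ×ˢ (B d ×ˢ B d),
        16 / (M : ℝ) ^ 4 * (((r.1 : ℝ) ^ 4)⁻¹ *
          (((r.2.2.1 : ℝ) ^ 2)⁻¹ * ((r.2.2.2 : ℝ) ^ 2)⁻¹)) := by
        refine sum_le_sum_of_injOn e ?_ ?_ ?_ fun _ _ => by positivity
        · intro z hz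
          obtain ⟨h1, h2, h3, h4, h5, h6, h7⟩ := he z hz
          have hk := hzK z hz
          have hbd : 0 < (e z).2.2.1 * (e z).1 := by omega
          have hcd : 0 < (e z).2.2.2 * (e z).1 := by omega
          have hb := Nat.pos_of_mul_pos_right hbd
          have hc := Nat.pos_of_mul_pos_right hcd
          have hd := Nat.pos_of_mul_pos_left hcd
          have hb' := Nat.le_mul_of_pos_right (e z).2.2.1 hd
          have hc' := Nat.le_mul_of_pos_right (e z).2.2.2 hd
          have hd' := Nat.le_mul_of_pos_left (e z).1 hc
          simp only [hB, Finset.mem_sigma, Finset.mem_product, Finset.mem_Icc, Finset.mem_range,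
            Finset.mem_filter]
          omega
        · intro z hz z' hz' heq
          obtain ⟨h1, h2, h3, h4, -⟩ := he z hz
          obtain ⟨h1', h2', h3', h4', -⟩ := he z' hz'
          rw [← heq] at h1' h2' h3' h4'
          refine Prod.ext (Prod.ext ?_ ?_) (Prod.ext ?_ ?_) <;> omega
        · rintro ⟨⟨n, m⟩, p, q⟩ hz
          obtain ⟨h1, h2, h3, h4, -⟩ := he _ hz
          exact quadTerm_le hM h1 h2 h3 h4
    _ = 16 / (M : ℝ) ^ 4 * ∑ d ∈ Finset.Icc 1 K,
          ((d : ℝ) ^ 3)⁻¹ * (∑ b ∈ B d, ((b : ℝ) ^ 2)⁻¹) ^ 2 := by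
        rw [Finset.sum_sigma, Finset.mul_sum]
        refine Finset.sum_congr rfl fun d hd => ?_
        have hd0 : (0 : ℝ) < d := by exact_mod_cast (Finset.mem_Icc.1 hd).1
        have h1 : ∑ x ∈ B d ×ˢ B d, ((x.1 : ℝ) ^ 2)⁻¹ * ((x.2 : ℝ) ^ 2)⁻¹ =
            (∑ b ∈ B d, ((b : ℝ) ^ 2)⁻¹) ^ 2 := by
          rw [sq (∑ b ∈ B d, _), Finset.sum_mul_sum, ← Finset.sum_product']
        rw [← Finset.mul_sum, Finset.sum_product]
        simp only [← Finset.mul_sum, Finset.sum_const, Finset.card_range, nsmul_eq_mul, h1]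
        field_simp
    _ ≤ 16 / (M : ℝ) ^ 4 * ((9 + Real.log M) / (M : ℝ) ^ 2) := by
        gcongr
        exact sum_inv_cube_mul_sq_le hM
    _ = _ := by field_simp

lemma sum_quadTerm_le {M : ℕ} (hM : 0 < M) (s : Finset ((ℕ × ℕ) × (ℕ × ℕ))) :
    ∑ z ∈ s, quadTerm M z ≤ (292 + 32 * Real.log M) / (M : ℝ) ^ 6 := by
  classical
  have hM' : (0 : ℝ) < M := by exact_mod_cast hM
  have hlt := sum_quadTerm_le_of_lt hM (s.filter fun z => z.2.1 < z.1.1)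
    fun z hz => (Finset.mem_filter.1 hz).2
  have hgt : ∑ z ∈ s.filter (fun z => z.1.1 < z.2.1), quadTerm M z ≤
      16 * (9 + Real.log M) / (M : ℝ) ^ 6 := by
    refine le_trans ?_ (sum_quadTerm_le_of_lt hM
      ((s.filter fun z => z.1.1 < z.2.1).image Prod.swap) fun z hz => ?_)
    · refine sum_le_sum_of_injOn Prod.swap (fun z hz => Finset.mem_image_of_mem _ hz)
        (Prod.swap_injective.injOn) (fun z _ => le_of_eq ?_) fun z _ => quadTerm_nonneg M z
      simp only [quadTerm, Prod.fst_swap, Prod.snd_swap, eq_comm]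
      split_ifs <;> ring
    · obtain ⟨y, hy, rfl⟩ := Finset.mem_image.1 hz
      exact (Finset.mem_filter.1 hy).2
  have heq : ∑ z ∈ s.filter (fun z => z.1.1 = z.2.1), quadTerm M z ≤ 4 / (M : ℝ) ^ 6 := by
    set t := (s.filter fun z => z.1.1 = z.2.1).filter fun z => quadTerm M z ≠ 0 with ht
    have hmem : ∀ z ∈ t, z.2 = z.1 := by
      rintro ⟨⟨n, m⟩, p, q⟩ hz
      obtain ⟨h1, h2⟩ := Finset.mem_filter.1 hz
      have h3 : n = p := (Finset.mem_filter.1 h1).2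
      have h4 : n ^ 2 + m ^ 2 = p ^ 2 + q ^ 2 := by
        by_contra h
        exact h2 (if_neg h)
      subst h3
      have h5 : m = q := Nat.pow_left_injective two_ne_zero (Nat.add_left_cancel h4)
      rw [h5]
    rw [← Finset.sum_filter_ne_zero]
    calc ∑ z ∈ t, quadTerm M z
        ≤ ∑ r ∈ t.image (fun z => z.1.1) ×ˢ t.image (fun z => z.1.2),
            tailWeight M r.1 ^ 2 * tailWeight M r.2 ^ 2 := by
          refine sum_le_sum_of_injOn Prod.fst (fun z hz => ?_) (fun z hz z' hz' h => ?_)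
            (fun z hz => ?_) fun _ _ => by positivity
          · exact Finset.mem_product.2 ⟨Finset.mem_image_of_mem (fun z => z.1.1) hz,
              Finset.mem_image_of_mem (fun z => z.1.2) hz⟩
          · exact Prod.ext h (by rw [hmem z hz, hmem z' hz', h])
          · rw [quadTerm, hmem z hz, if_pos rfl]
            exact le_of_eq (by ring)
      _ = (∑ n ∈ t.image (fun z => z.1.1), tailWeight M n ^ 2) *
            ∑ n ∈ t.image (fun z => z.1.2), tailWeight M n ^ 2 := by
          rw [Finset.sum_mul_sum, ← Finset.sum_product']
      _ ≤ 2 / (M : ℝ) ^ 3 * (2 / (M : ℝ) ^ 3) :=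
          mul_le_mul (sum_tailWeight_sq_le hM _) (sum_tailWeight_sq_le hM _)
            (Finset.sum_nonneg fun _ _ => sq_nonneg _) (by positivity)
      _ = _ := by field_simp; norm_num
  have hsplit : ∑ z ∈ s, quadTerm M z = ∑ z ∈ s.filter (fun z => z.1.1 = z.2.1), quadTerm M z +
      (∑ z ∈ s.filter (fun z => z.2.1 < z.1.1), quadTerm M z +
      ∑ z ∈ s.filter (fun z => z.1.1 < z.2.1), quadTerm M z) := by
    simp only [Finset.sum_filter, ← Finset.sum_add_distrib]
    refine Finset.sum_congr rfl fun z _ => ?_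
    rcases lt_trichotomy z.1.1 z.2.1 with h | h | h
    · simp [h, h.ne, h.not_gt]
    · simp [h]
    · simp [h, h.ne', h.not_gt]
  rw [hsplit]
  refine (add_le_add heq (add_le_add hlt hgt)).trans (le_of_eq ?_)
  ring

/-- There exist `c, C > 0` and `N₀` such that for every `N ≥ N₀`,
`c · log N ≤ F_R(N) ≤ C · log N`. -/
theorem riemann_flatness_HP_log :
    ∃ c C : ℝ, 0 < c ∧ 0 < C ∧ ∃ N₀ : ℕ, ∀ N : ℕ, N₀ ≤ N →
      c * Real.log N ≤ flatnessHP N ∧ flatnessHP N ≤ C * Real.log N := by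
  refine ⟨1 / (64 * 10 ^ 8), 256 * 324, by norm_num, by norm_num, 3, fun N hN => ?_⟩
  obtain ⟨M, hM, hM0, hNM, hMN⟩ : ∃ M, (∀ n, N ≤ n * n ↔ M ≤ n) ∧ 0 < M ∧ N ≤ M ^ 2 ∧ M ≤ N := by
    have h : ∀ n, N ≤ n * n ↔ Nat.sqrt (N - 1) + 1 ≤ n := fun n => by
      rw [Nat.succ_le_iff, Nat.sqrt_lt]
      omega
    refine ⟨Nat.sqrt (N - 1) + 1, h, Nat.succ_pos _, ?_, ?_⟩
    · rw [sq]
      exact (h _).2 le_rfl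
    · exact (h N).1 (Nat.le_mul_self N)
  have hT := hasSum_integral_RiemannHigh_pow_four hM
  have hS := hasSum_integral_RiemannHigh_sq hM
  have hT1 := log_le_of_hasSum_quadTerm hM0 hT
  have hT2 := hasSum_le_of_sum_le hT (sum_quadTerm_le hM0)
  have hS1 := le_of_hasSum_tailWeight_sq hM0 hS
  have hS2 := hasSum_le_of_sum_le hS (sum_tailWeight_sq_le hM0)
  unfold flatnessHP
  set T := ∫ x in (0:ℝ)..1, ‖RiemannHigh N x‖ ^ 4
  set S := ∫ x in (0:ℝ)..1, ‖RiemannHigh N x‖ ^ 2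
  have hM' : (0 : ℝ) < M := by exact_mod_cast hM0
  have hN' : (0 : ℝ) < N := by exact_mod_cast (show 0 < N by omega)
  have hS0 : 0 < S := lt_of_lt_of_le (by positivity) hS1
  have hlog1 : Real.log N ≤ 2 * Real.log M := by
    have := Real.log_le_log hN' (show (N : ℝ) ≤ (M : ℝ) ^ 2 by exact_mod_cast hNM)
    rwa [Real.log_pow, Nat.cast_ofNat] at this
  have hlog2 : Real.log M ≤ Real.log N := Real.log_le_log hM' (by exact_mod_cast hMN)
  have hlogN : 1 ≤ Real.log N := by
    rw [Real.le_log_iff_exp_le hN']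
    have h3 : (3 : ℝ) ≤ N := by exact_mod_cast hN
    linarith [Real.exp_one_lt_d9]
  constructor
  · rw [le_div_iff₀ (by positivity)]
    calc 1 / (64 * 10 ^ 8) * Real.log N * S ^ 2
        ≤ 1 / (64 * 10 ^ 8) * (2 * Real.log M) * (2 / (M : ℝ) ^ 3) ^ 2 := by
          gcongr
      _ = Real.log M / (8 * 10 ^ 8 * (M : ℝ) ^ 6) := by
          field_simp
          ring
      _ ≤ T := hT1
  · rw [div_le_iff₀ (by positivity)]
    calc T ≤ (292 + 32 * Real.log M) / (M : ℝ) ^ 6 := hT2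
      _ ≤ (324 * Real.log N) / (M : ℝ) ^ 6 := by
          gcongr
          linarith
      _ = 256 * 324 * Real.log N * (1 / (16 * (M : ℝ) ^ 3)) ^ 2 := by
          field_simp
          norm_num
      _ ≤ 256 * 324 * Real.log N * S ^ 2 := by
          gcongr
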